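/- arXiv:1606.04293 — 6 statements merged into one kernel-verified Lean document; each statement's English description precedes it below -/
import Mathlib

section
/- Let Γ be a group generated by a finite set X and n ≥ 1. If F' is a set of minimal cardinality among all nonempty finite subsets F ⊆ Γ satisfying |∂_X F|/|F| ≤ 1/n (where ∂_X F := {f ∈ F : ∃ x ∈ X, xf ∉ F}), then F' is connected in the Cayley graph of Γ with respect to X: for any two elements f, f' ∈ F' there is a finite sequence f = f₀, f₁, …, f_k = f' of elements of F' such that for each i there exists x ∈ X with f_{i+1} = x f_i or f_i = x f_{i+1}. -/
open scoped Pointwise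

variable {G : Type*} [Group G] [DecidableEq G]

/-- `F` is an `n`-Følner set for the group generated by `X`. -/
def IsFolner (X : Finset G) (n : ℕ) (F : Finset G) : Prop :=
  F.Nonempty ∧ ∀ x ∈ X, ((F \ F.image (x * ·)).card : ℚ) / F.card ≤ 1 / n

/-- Word length with respect to `X ∪ X⁻¹`. -/
noncomputable def wordLength (X : Set G) (g : G) : ℕ :=
  sInf {k | ∃ w : List G, (∀ a ∈ w, a ∈ X ∨ a⁻¹ ∈ X) ∧ w.length = k ∧ w.prod = g}

/-- The Følner function. -/
noncomputable def folnerFn (X : Finset G) (n : ℕ) : ℕ :=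
  sInf {k | ∃ F : Finset G, IsFolner X n F ∧ F.card = k}

/-- `C_n(y₁,…,y_s)`. -/
def Cube (n : ℕ) {s : ℕ} (y : Fin s → G) : Finset G :=
  Finset.image (fun i : Fin s → Fin n => (List.ofFn fun j => y j ^ (i j : ℕ)).prod) Finset.univ

noncomputable def distortion (X Y : Finset G) (N : Subgroup G) (m : ℕ) : ℕ :=
  sSup {k | ∃ ω ∈ N, wordLength (X : Set G) ω ≤ m ∧ wordLength (Y : Set G) ω = k}

open Classical in
/-- The inner `X`-boundary `∂_X F = {f ∈ F : ∃ x ∈ X, xf ∉ F}`. -/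
noncomputable def innerBoundary (X F : Finset G) : Finset G :=
  F.filter (fun f => ∃ x ∈ X, x * f ∉ F)

theorem exists_chain_snoc {G : Type*} {p : G → Prop} {r : G → G → Prop} {a b d : G}
    (h : ∃ (k : ℕ) (c : ℕ → G), c 0 = a ∧ c k = b ∧ (∀ i ≤ k, p (c i)) ∧
      ∀ i < k, r (c i) (c (i + 1))) (hd : p d) (hbd : r b d) :
    ∃ (k : ℕ) (c : ℕ → G), c 0 = a ∧ c k = d ∧ (∀ i ≤ k, p (c i)) ∧
      ∀ i < k, r (c i) (c (i + 1)) := by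
  obtain ⟨k, c, h0, hk, hp, hr⟩ := h
  refine ⟨k + 1, fun i => if i ≤ k then c i else d, by simp [h0], by simp, ?_, ?_⟩
  · intro i _
    dsimp only
    split_ifs with hi
    exacts [hp i hi, hd]
  · intro i hi
    rcases (Nat.lt_succ_iff.mp hi).lt_or_eq with h | rfl
    · simpa [h.le, Nat.succ_le_of_lt h] using hr i h
    · simpa [hk] using hbd

/-- If no edge joins `A` to `F \ A`, the boundary of `F` is at least the sum of the boundaries of
the two pieces. -/
theorem card_innerBoundary_add_card_innerBoundary_sdiff_le {G : Type*} [Group G] [DecidableEq G]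
    (X F A : Finset G) (hA : A ⊆ F)
    (hedge : ∀ x ∈ X, ∀ g ∈ F, x * g ∈ F → (g ∈ A ↔ x * g ∈ A)) :
    (innerBoundary X A).card + (innerBoundary X (F \ A)).card ≤ (innerBoundary X F).card := by
  rw [← Finset.card_union_of_disjoint]
  · refine Finset.card_le_card fun g hg => ?_
    simp only [innerBoundary, Finset.mem_union, Finset.mem_filter, Finset.mem_sdiff] at hg ⊢
    rcases hg with ⟨hg, x, hx, h⟩ | ⟨⟨hg, hgA⟩, x, hx, h⟩
    · exact ⟨hA hg, x, hx, fun h' => h ((hedge x hx g (hA hg) h').1 hg)⟩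
    · exact ⟨hg, x, hx, fun h' => h ⟨h', fun h'' => hgA ((hedge x hx g hg h').2 h'')⟩⟩
  · exact Finset.disjoint_sdiff.mono (Finset.filter_subset _ _) (Finset.filter_subset _ _)

/-- An optimal Følner set (of minimal cardinality among nonempty finite sets with
`|∂_X F|/|F| ≤ 1/n`) is connected in the Cayley graph of `Γ` with respect to `X`. -/
theorem optimal_folner_connected {G : Type*} [Group G] [DecidableEq G]
    (X : Finset G) (hX : Subgroup.closure (X : Set G) = ⊤)
    (n : ℕ) (hn : 1 ≤ n) (F' : Finset G) (hne : F'.Nonempty)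
    (hbd : ((innerBoundary X F').card : ℚ) / F'.card ≤ 1 / n)
    (hmin : ∀ F : Finset G, F.Nonempty →
      ((innerBoundary X F).card : ℚ) / F.card ≤ 1 / n → F'.card ≤ F.card) :
    ∀ f ∈ F', ∀ f' ∈ F', ∃ (k : ℕ) (c : ℕ → G),
      c 0 = f ∧ c k = f' ∧ (∀ i ≤ k, c i ∈ F') ∧
      ∀ i < k, ∃ x ∈ X, c (i + 1) = x * c i ∨ c i = x * c (i + 1) := by
  classical
  intro f hf
  let r : G → G → Prop := fun a b => ∃ x ∈ X, b = x * a ∨ a = x * b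
  let A : Finset G := F'.filter fun z => ∃ (k : ℕ) (c : ℕ → G),
    c 0 = f ∧ c k = z ∧ (∀ i ≤ k, c i ∈ F') ∧ ∀ i < k, r (c i) (c (i + 1))
  have hAF : A ⊆ F' := Finset.filter_subset _ _
  have hfA : f ∈ A := Finset.mem_filter.2 ⟨hf, 0, fun _ => f, by simp [hf]⟩
  have hedge : ∀ x ∈ X, ∀ g ∈ F', x * g ∈ F' → (g ∈ A ↔ x * g ∈ A) := fun x hx g hg hxg =>
    ⟨fun h => Finset.mem_filter.2
        ⟨hxg, exists_chain_snoc (Finset.mem_filter.1 h).2 hxg ⟨x, hx, Or.inl rfl⟩⟩,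
      fun h => Finset.mem_filter.2
        ⟨hg, exists_chain_snoc (Finset.mem_filter.1 h).2 hg ⟨x, hx, Or.inr rfl⟩⟩⟩
  have hsum := card_innerBoundary_add_card_innerBoundary_sdiff_le X F' A hAF hedge
  have hn0 : (0 : ℚ) < n := by exact_mod_cast hn
  have key : ∀ F : Finset G, F.Nonempty →
      (((innerBoundary X F).card : ℚ) / F.card ≤ 1 / n ↔
        n * (innerBoundary X F).card ≤ F.card) := by
    intro F hF
    have hF0 : (0 : ℚ) < F.card := by exact_mod_cast hF.card_pos
    rw [div_le_div_iff₀ hF0 hn0, one_mul, mul_comm]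
    exact_mod_cast Iff.rfl
  intro f' hf'
  by_contra hcon
  have hf'A : f' ∉ A := fun h => hcon (Finset.mem_filter.1 h).2
  have hAne : A.Nonempty := ⟨f, hfA⟩
  have hBne : (F' \ A).Nonempty := ⟨f', Finset.mem_sdiff.2 ⟨hf', hf'A⟩⟩
  have hcard := Finset.card_sdiff_add_card_eq_card hAF
  have hApos := hAne.card_pos
  have hBpos := hBne.card_pos
  have hF := (key F' hne).1 hbd
  have hA : ¬ n * (innerBoundary X A).card ≤ A.card := fun h => by
    have := hmin A hAne ((key A hAne).2 h)
    omega
  have hB : ¬ n * (innerBoundary X (F' \ A)).card ≤ (F' \ A).card := fun h => by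
    have := hmin _ hBne ((key _ hBne).2 h)
    omega
  have hmul := Nat.mul_le_mul_left n hsum
  rw [mul_add] at hmul
  omega
end

section
/- Let Γ be an amenable group generated by a finite set X, and let n ≥ 1. Then there exists an n-Følner set F for Γ with respect to X such that |F| ≤ F_{Γ,X}(|X| n) and F ⊆ B_{|F|}(Γ), i.e. every element of F has word length at most |F| with respect to X ∪ X⁻¹ (and moreover 1_Γ ∈ F). -/
open scoped Pointwise

variable {G : Type*} [Group G] [DecidableEq G]

/-- The total number of boundary points of `F`, summed over the generators in `X`. -/
def boundaryCard (X F : Finset G) : ℕ :=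
  ∑ x ∈ X, (F \ F.image (x * ·)).card

theorem mem_image_mul_left_iff (F : Finset G) (x g : G) :
    g ∈ F.image (x * ·) ↔ x⁻¹ * g ∈ F := by
  simp only [Finset.mem_image]
  constructor
  · rintro ⟨a, ha, rfl⟩
    simpa using ha
  · exact fun h => ⟨_, h, by simp⟩

theorem card_div_card_le_iff {α : Type*} {n : ℕ} (hn : 1 ≤ n) {A F : Finset α} (hF : F.Nonempty) :
    (A.card : ℚ) / F.card ≤ 1 / n ↔ n * A.card ≤ F.card := by
  have hF' : (0 : ℚ) < F.card := by exact_mod_cast hF.card_pos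
  have hn' : (0 : ℚ) < n := by exact_mod_cast hn
  rw [div_le_div_iff₀ hF' hn', one_mul, mul_comm]
  exact_mod_cast Iff.rfl

theorem IsFolner.mul_boundaryCard_le {X : Finset G} {n : ℕ} (hn : 1 ≤ n) {F : Finset G}
    (hF : IsFolner X (X.card * n) F) : n * boundaryCard X F ≤ F.card := by
  rcases X.eq_empty_or_nonempty with rfl | hX
  · simp [boundaryCard]
  have hXc := hX.card_pos
  have h : ∀ x ∈ X, X.card * n * (F \ F.image (x * ·)).card ≤ F.card := fun x hx =>
    (card_div_card_le_iff (Nat.mul_pos hXc hn) hF.1).1 (hF.2 x hx)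
  have h2 := Finset.sum_le_card_nsmul X _ _ h
  rw [← Finset.mul_sum, smul_eq_mul, mul_assoc] at h2
  exact Nat.le_of_mul_le_mul_left h2 hXc

theorem IsFolner.of_mul_boundaryCard_le {X : Finset G} {n : ℕ} (hn : 1 ≤ n) {F : Finset G}
    (hF : F.Nonempty) (h : n * boundaryCard X F ≤ F.card) : IsFolner X n F := by
  refine ⟨hF, fun x hx => (card_div_card_le_iff hn hF).2 (le_trans ?_ h)⟩
  exact Nat.mul_le_mul_left n
    (Finset.single_le_sum (f := fun x => (F \ F.image (x * ·)).card) (fun _ _ => zero_le) hx)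

theorem boundaryCard_image_mul_right (X F : Finset G) (g : G) :
    boundaryCard X (F.image (· * g)) = boundaryCard X F := by
  refine Finset.sum_congr rfl fun x _ => ?_
  rw [← Finset.card_image_of_injective (F \ F.image (x * ·)) (mul_left_injective g),
    Finset.image_sdiff _ _ (mul_left_injective g), Finset.image_image, Finset.image_image]
  simp only [Function.comp_def, mul_assoc]

/-- The boundary is additive when `F` is split into two parts with no edges between them. -/
theorem boundaryCard_add_boundaryCard_sdiff {X F A : Finset G} (hA : A ⊆ F)
    (hclosed : ∀ x ∈ X, ∀ g, g ∈ F → x * g ∈ F → (g ∈ A ↔ x * g ∈ A)) :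
    boundaryCard X A + boundaryCard X (F \ A) = boundaryCard X F := by
  rw [boundaryCard, boundaryCard, boundaryCard, ← Finset.sum_add_distrib]
  refine Finset.sum_congr rfl fun x hx => ?_
  rw [← Finset.card_union_of_disjoint]
  · congr 1
    ext g
    have h := hclosed x hx (x⁻¹ * g)
    rw [mul_inv_cancel_left] at h
    have h1 := @hA g
    have h2 := @hA (x⁻¹ * g)
    simp only [Finset.mem_union, Finset.mem_sdiff, mem_image_mul_left_iff]
    tauto
  · rw [Finset.disjoint_left]
    intro g hg hg'
    simp only [Finset.mem_sdiff] at hg hg'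
    exact hg'.1.2 hg.1

/-- A set of minimal cardinality among those with small boundary is connected. -/
theorem eq_of_minimal_of_closed {X F A : Finset G} {n : ℕ}
    (hF : n * boundaryCard X F ≤ F.card)
    (hmin : ∀ E : Finset G, E.Nonempty → n * boundaryCard X E ≤ E.card → F.card ≤ E.card)
    (hA : A ⊆ F) (hne : A.Nonempty)
    (hclosed : ∀ x ∈ X, ∀ g, g ∈ F → x * g ∈ F → (g ∈ A ↔ x * g ∈ A)) : A = F := by
  by_contra hAF
  have hB : (F \ A).Nonempty := Finset.sdiff_nonempty.2 fun h => hAF (hA.antisymm h)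
  have hadd := boundaryCard_add_boundaryCard_sdiff hA hclosed
  have hcard := Finset.card_sdiff_add_card_eq_card hA
  have hA0 := hne.card_pos
  have hB0 := hB.card_pos
  have h1 : A.card < n * boundaryCard X A := by
    by_contra! h
    have := hmin A hne h
    omega
  have h2 : (F \ A).card < n * boundaryCard X (F \ A) := by
    by_contra! h
    have := hmin _ hB h
    omega
  rw [← hadd, mul_add] at hF
  omega

theorem wordLength_one {G : Type*} [Group G] (X : Set G) : wordLength X 1 = 0 :=
  Nat.sInf_eq_zero.2 (Or.inl ⟨[], by simp, rfl, rfl⟩)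

theorem wordLength_mul_le {G : Type*} [Group G] {X : Set G} (hX : Subgroup.closure X = ⊤) {x : G}
    (hx : x ∈ X ∨ x⁻¹ ∈ X) (g : G) : wordLength X (x * g) ≤ wordLength X g + 1 := by
  have hne : {k | ∃ w : List G, (∀ a ∈ w, a ∈ X ∨ a⁻¹ ∈ X) ∧ w.length = k ∧
      w.prod = g}.Nonempty := by
    have hmem : g ∈ Submonoid.closure (X ∪ X⁻¹) := by
      rw [← Subgroup.closure_toSubmonoid, hX]
      exact Subgroup.mem_top g
    obtain ⟨w, hw, hg⟩ := Submonoid.exists_list_of_mem_closure hmem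
    exact ⟨_, w, hw, rfl, hg⟩
  obtain ⟨w, hw, hlen, hprod⟩ := Nat.sInf_mem hne
  refine Nat.sInf_le ⟨x :: w, ?_, by rw [List.length_cons, hlen]; rfl, by simp [hprod]⟩
  simpa using ⟨hx, hw⟩

/-- A connected set containing the identity lies in the ball of radius its cardinality. -/
theorem wordLength_le_card_of_connected {G : Type*} [Group G] [DecidableEq G]
    {X F : Finset G} (hX : Subgroup.closure (X : Set G) = ⊤) (h1 : (1 : G) ∈ F)
    (hconn : ∀ A ⊆ F, A.Nonempty →
      (∀ x ∈ X, ∀ g, g ∈ F → x * g ∈ F → (g ∈ A ↔ x * g ∈ A)) → A = F)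
    {g : G} (hg : g ∈ F) : wordLength (X : Set G) g ≤ F.card := by
  set A : ℕ → Finset G := fun k => F.filter fun g => wordLength (X : Set G) g ≤ k with hAdef
  have hone : ∀ k, 1 ∈ A k := fun k => by simp [hAdef, h1, wordLength_one]
  have hmono : ∀ k, A k ⊆ A (k + 1) := fun k a ha => by
    simp only [hAdef, Finset.mem_filter] at ha ⊢
    exact ⟨ha.1, ha.2.trans k.le_succ⟩
  have hstab : ∀ k, A k = A (k + 1) → A k = F := fun k hk => by
    refine hconn _ (Finset.filter_subset _ _) ⟨1, hone k⟩
      fun x hx a ha hxa => ⟨fun h => ?_, fun h => ?_⟩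
    · rw [hk]
      have := wordLength_mul_le hX (x := x) (Or.inl hx) a
      simp only [hAdef, Finset.mem_filter] at h ⊢
      exact ⟨hxa, by omega⟩
    · rw [hk]
      have := wordLength_mul_le hX (x := x⁻¹) (Or.inr (by simpa using hx)) (x * a)
      rw [inv_mul_cancel_left] at this
      simp only [hAdef, Finset.mem_filter] at h ⊢
      exact ⟨ha, by omega⟩
  have hgrow : ∀ k, A k = F ∨ k + 1 ≤ (A k).card := by
    intro k
    induction k with
    | zero => exact Or.inr (Finset.card_pos.2 ⟨1, hone 0⟩)
    | succ k ih =>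
      by_cases hk : A k = A (k + 1)
      · exact Or.inl (hk ▸ hstab k hk)
      · have hlt := Finset.card_lt_card ((hmono k).ssubset_of_ne hk)
        rcases ih with h | h
        · exact absurd ((hmono k).antisymm (h ▸ Finset.filter_subset _ _)) hk
        · exact Or.inr (by omega)
  have hfull : A F.card = F := by
    refine (hgrow F.card).resolve_right fun h => ?_
    have := Finset.card_le_card
      (Finset.filter_subset (fun g => wordLength (X : Set G) g ≤ F.card) F)
    simp only [hAdef] at h
    omega
  rw [← hfull] at hg
  exact (Finset.mem_filter.1 hg).2

/-- For an amenable group generated by a finite set `X` there is an `n`-Følner set `F`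
containing the identity, with `|F| ≤ F_{Γ,X}(|X|·n)` and `F ⊆ B_{|F|}(Γ)`. -/
theorem exists_small_connected_folner {G : Type*} [Group G] [DecidableEq G]
    (X : Finset G) (hX : Subgroup.closure (X : Set G) = ⊤)
    (ham : ∀ m : ℕ, 1 ≤ m → ∃ F : Finset G, IsFolner X m F)
    (n : ℕ) (hn : 1 ≤ n) :
    ∃ F : Finset G, IsFolner X n F ∧ (1 : G) ∈ F ∧
      F.card ≤ folnerFn X (X.card * n) ∧
      ∀ g ∈ F, wordLength (X : Set G) g ≤ F.card := by
  obtain ⟨F₀, hF₀, hcard₀⟩ : folnerFn X (X.card * n) ∈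
      {k | ∃ F : Finset G, IsFolner X (X.card * n) F ∧ F.card = k} := by
    refine Nat.sInf_mem ?_
    rcases X.eq_empty_or_nonempty with rfl | hne
    · exact ⟨_, {1}, ⟨by simp, by simp⟩, rfl⟩
    · obtain ⟨F, hF⟩ := ham (X.card * n) (Nat.mul_pos hne.card_pos hn)
      exact ⟨_, F, hF, rfl⟩
  obtain ⟨E, ⟨⟨a, ha⟩, hE⟩, hmin⟩ := WellFounded.has_min
    (measure (Finset.card : Finset G → ℕ)).wf
    {F | F.Nonempty ∧ n * boundaryCard X F ≤ F.card} ⟨F₀, hF₀.1, hF₀.mul_boundaryCard_le hn⟩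
  have hmin' : ∀ F : Finset G, F.Nonempty → n * boundaryCard X F ≤ F.card →
      E.card ≤ F.card := fun F h1 h2 => not_lt.1 (hmin F ⟨h1, h2⟩)
  have hcard : (E.image (· * a⁻¹)).card = E.card :=
    Finset.card_image_of_injective _ (mul_left_injective _)
  have h1 : (1 : G) ∈ E.image (· * a⁻¹) := Finset.mem_image.2 ⟨a, ha, mul_inv_cancel a⟩
  have hsmall : n * boundaryCard X (E.image (· * a⁻¹)) ≤ (E.image (· * a⁻¹)).card := by
    rwa [boundaryCard_image_mul_right, hcard]
  refine ⟨E.image (· * a⁻¹), .of_mul_boundaryCard_le hn ⟨1, h1⟩ hsmall, h1, ?_, fun g hg => ?_⟩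
  · rw [hcard, ← hcard₀]
    exact hmin' F₀ hF₀.1 (hF₀.mul_boundaryCard_le hn)
  · exact wordLength_le_card_of_connected hX h1
      (fun A hA hne hcl => eq_of_minimal_of_closed hsmall (hcard.symm ▸ hmin') hA hne hcl) hg
end

section
/- Let Γ be a group generated by L₁ ∪ L₂, where L₁ and L₂ are disjoint finite subsets, let H₁ = ⟨L₁⟩ and H₂ = ⟨L₂⟩, and let H₁^Γ denote the normal closure of H₁ in Γ. Suppose H₁^Γ is abelian, H₁^Γ ∩ H₂ = {1} and Γ = H₁^Γ · H₂ (so Γ = H₁^Γ ⋊ H₂ internally). Then for every n ≥ 1 and every n-Følner set A for H₂ with respect to L₂, the set A · C_n(L₁^A) is an n-Følner set for Γ with respect to L₁ ∪ L₂, where L₁^A := {a⁻¹ x a : a ∈ A, x ∈ L₁} (a finite set of pairwise commuting elements of H₁^Γ) and C_n(L₁^A) is formed from any finite enumeration of L₁^A. -/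
open scoped Pointwise

variable {G : Type*} [Group G] [DecidableEq G]

open scoped IsMulCommutative in
/-- In a list product of powers of pairwise commuting elements, raising one exponent by `k`
multiplies the product by the `k`-th power of the corresponding element. -/
theorem prod_ofFn_pow_add_single {G : Type*} [Group G] {s : ℕ} {y : Fin s → G}
    (hc : ∀ i j, Commute (y i) (y j)) (e : Fin s → ℕ) (j : Fin s) (k : ℕ) :
    (List.ofFn fun t => y t ^ (e t + Pi.single (M := fun _ => ℕ) j k t)).prod =
      y j ^ k * (List.ofFn fun t => y t ^ e t).prod := by
  have : IsMulCommutative (Subgroup.closure (Set.range y)) :=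
    Subgroup.isMulCommutative_closure <| by
      rintro _ ⟨i, rfl⟩ _ ⟨j, rfl⟩
      exact hc i j
  let z : Fin s → Subgroup.closure (Set.range y) :=
    fun t => ⟨y t, Subgroup.subset_closure ⟨t, rfl⟩⟩
  have key (f : Fin s → ℕ) : (List.ofFn fun t => y t ^ f t).prod =
      (Subgroup.closure (Set.range y)).subtype (∏ t, z t ^ f t) := by
    rw [← List.prod_ofFn, map_list_prod, List.map_ofFn]
    rfl
  have hz : ∏ t, z t ^ (e t + Pi.single (M := fun _ => ℕ) j k t) =
      z j ^ k * ∏ t, z t ^ e t := by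
    simp_rw [pow_add]
    rw [Finset.prod_mul_distrib, mul_comm]
    congr 1
    rw [Finset.prod_eq_single j]
    · simp
    · intro t _ ht
      simp [Pi.single_eq_of_ne ht]
    · simp
  rw [key e, key fun t => e t + Pi.single (M := fun _ => ℕ) j k t, hz, map_mul, map_pow]
  rfl

theorem mem_cube_iff {n s : ℕ} {y : Fin s → G} {g : G} :
    g ∈ Cube n y ↔
      ∃ e : Fin s → ℕ, (∀ t, e t < n) ∧ (List.ofFn fun t => y t ^ e t).prod = g := by
  simp only [Cube, Finset.mem_image, Finset.mem_univ, true_and]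
  constructor
  · rintro ⟨i, rfl⟩
    exact ⟨fun t => i t, fun t => (i t).2, rfl⟩
  · rintro ⟨e, he, rfl⟩
    exact ⟨fun t => ⟨e t, he t⟩, rfl⟩

theorem cube_nonempty {n s : ℕ} (hn : 1 ≤ n) (y : Fin s → G) : (Cube n y).Nonempty :=
  ⟨_, mem_cube_iff.2 ⟨fun _ => 0, fun _ => hn, rfl⟩⟩

theorem cube_subset {n s : ℕ} {y : Fin s → G} {N : Subgroup G} (hy : ∀ t, y t ∈ N) :
    ∀ g ∈ Cube n y, g ∈ N := by
  intro g hg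
  obtain ⟨e, -, rfl⟩ := mem_cube_iff.1 hg
  refine Subgroup.list_prod_mem N fun x hx => ?_
  obtain ⟨t, rfl⟩ := (List.mem_ofFn' _ _).1 hx
  exact N.pow_mem (hy t) _

/-- An element of the cube outside the translate by `y j` starts a `y j`-progression of length
`n` inside the cube. -/
theorem pow_mul_mem_cube {n s : ℕ} {y : Fin s → G} (hc : ∀ i j, Commute (y i) (y j))
    (j : Fin s) {c : G} (hcC : c ∈ Cube n y) (hcy : c ∉ (Cube n y).image (y j * ·))
    {k : ℕ} (hk : k < n) : y j ^ k * c ∈ Cube n y := by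
  obtain ⟨e, he, rfl⟩ := mem_cube_iff.1 hcC
  have hej : e j = 0 := by
    by_contra h
    refine hcy (Finset.mem_image.2 ⟨_, mem_cube_iff.2
      ⟨fun t => e t - Pi.single (M := fun _ => ℕ) j 1 t,
        fun t => (Nat.sub_le _ _).trans_lt (he t), rfl⟩, ?_⟩)
    have h' := prod_ofFn_pow_add_single hc
      (fun t => e t - Pi.single (M := fun _ => ℕ) j 1 t) j 1
    rw [pow_one] at h'
    refine h'.symm.trans (congrArg (fun f : Fin s → ℕ => (List.ofFn fun t => y t ^ f t).prod) ?_)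
    funext t
    rcases eq_or_ne t j with rfl | ht
    · simp only [Pi.single_eq_same]
      omega
    · simp [Pi.single_eq_of_ne ht]
  refine mem_cube_iff.2 ⟨fun t => e t + Pi.single (M := fun _ => ℕ) j k t, fun t => ?_,
    prod_ofFn_pow_add_single hc e j k⟩
  rcases eq_or_ne t j with rfl | ht
  · simpa [hej] using hk
  · simpa [Pi.single_eq_of_ne ht] using he t

/-- If every element of `C` outside `g C` starts a `g`-progression of length `n` inside `C`,
then these progressions are disjoint, so there are at most `|C| / n` of them. -/
theorem mul_card_sdiff_image_le {n : ℕ} {C : Finset G} {g : G}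
    (h : ∀ c ∈ C \ C.image (g * ·), ∀ k < n, g ^ k * c ∈ C) :
    n * (C \ C.image (g * ·)).card ≤ C.card := by
  have hle : ∀ c ∈ C \ C.image (g * ·), ∀ c' ∈ C \ C.image (g * ·), ∀ k l, l < n →
      g ^ k * c = g ^ l * c' → l ≤ k := by
    intro c hc c' hc' k l hl heq
    by_contra! hkl
    obtain ⟨m, rfl⟩ := Nat.exists_eq_add_of_lt hkl
    refine (Finset.mem_sdiff.1 hc).2 (Finset.mem_image.2 ⟨g ^ m * c', h c' hc' m (by omega), ?_⟩)
    rw [add_assoc, pow_add, mul_assoc] at heq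
    simpa [pow_succ', mul_assoc] using (mul_left_cancel heq).symm
  rw [← Finset.card_range n, ← Finset.card_product]
  refine Finset.card_le_card_of_injOn (fun p => g ^ p.1 * p.2) ?_ ?_
  · rintro ⟨k, c⟩ hp
    obtain ⟨hk, hc⟩ := Finset.mem_product.1 hp
    exact h c hc k (Finset.mem_range.1 hk)
  · rintro ⟨k, c⟩ hp ⟨l, c'⟩ hq heq
    obtain ⟨hk, hc⟩ := Finset.mem_product.1 hp
    obtain ⟨hl, hc'⟩ := Finset.mem_product.1 hq
    have hkl : k = l := le_antisymm
      (hle c' hc' c hc l k (Finset.mem_range.1 hk) heq.symm)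
      (hle c hc c' hc' k l (Finset.mem_range.1 hl) heq)
    subst hkl
    exact Prod.ext rfl (mul_left_cancel heq)

theorem card_div_card_le_one_div_iff {n a b : ℕ} (hn : 0 < n) (hb : 0 < b) :
    (a : ℚ) / b ≤ 1 / n ↔ n * a ≤ b := by
  rw [div_le_div_iff₀ (by exact_mod_cast hb) (by exact_mod_cast hn), one_mul, mul_comm]
  exact_mod_cast Iff.rfl

theorem card_mul_of_inf_eq_bot {N H : Subgroup G} (hNH : N ⊓ H = ⊥) {A C : Finset G}
    (hA : ∀ a ∈ A, a ∈ H) (hC : ∀ c ∈ C, c ∈ N) : (A * C).card = A.card * C.card := by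
  refine Finset.card_mul_iff.2 ?_
  rintro ⟨a, c⟩ hp ⟨a', c'⟩ hq heq
  obtain ⟨ha, hc⟩ := hp
  obtain ⟨ha', hc'⟩ := hq
  have heq' : a * c = a' * c' := heq
  have h1 : a'⁻¹ * a = c' * c⁻¹ := by
    rw [inv_mul_eq_iff_eq_mul, ← mul_assoc, ← heq', mul_inv_cancel_right]
  have h2 : a'⁻¹ * a ∈ N ⊓ H :=
    ⟨h1 ▸ N.mul_mem (hC _ hc') (N.inv_mem (hC _ hc)),
      H.mul_mem (H.inv_mem (hA _ ha')) (hA _ ha)⟩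
  rw [hNH, Subgroup.mem_bot, inv_mul_eq_one] at h2
  subst h2
  exact Prod.ext rfl (mul_left_cancel heq')

theorem mul_sdiff_image_mul_subset (A C : Finset G) (x : G) :
    (A * C) \ (A * C).image (x * ·) ⊆ (A \ A.image (x * ·)) * C := by
  intro g hg
  obtain ⟨hg, hgx⟩ := Finset.mem_sdiff.1 hg
  obtain ⟨a, ha, c, hc, rfl⟩ := Finset.mem_mul.1 hg
  refine Finset.mul_mem_mul (Finset.mem_sdiff.2 ⟨ha, fun hax => hgx ?_⟩) hc
  obtain ⟨b, hb, rfl⟩ := Finset.mem_image.1 hax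
  exact Finset.mem_image.2 ⟨b * c, Finset.mul_mem_mul hb hc, (mul_assoc _ _ _).symm⟩

theorem mul_sdiff_image_mul_subset_biUnion (A C : Finset G) (x : G) :
    (A * C) \ (A * C).image (x * ·) ⊆
      A.biUnion fun a => (C \ C.image (a⁻¹ * x * a * ·)).image (a * ·) := by
  intro g hg
  obtain ⟨hg, hgx⟩ := Finset.mem_sdiff.1 hg
  obtain ⟨a, ha, c, hc, rfl⟩ := Finset.mem_mul.1 hg
  refine Finset.mem_biUnion.2 ⟨a, ha, Finset.mem_image.2
    ⟨c, Finset.mem_sdiff.2 ⟨hc, fun hcx => hgx ?_⟩, rfl⟩⟩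
  obtain ⟨b, hb, rfl⟩ := Finset.mem_image.1 hcx
  exact Finset.mem_image.2 ⟨a * b, Finset.mul_mem_mul ha hb, by group⟩

/-- If `Γ = H₁^Γ ⋊ H₂` with `H₁^Γ` abelian, then for every `n`-Følner set `A` of `H₂`
(w.r.t. `L₂`), the set `A · C_n(L₁^A)` is an `n`-Følner set of `Γ` w.r.t. `L₁ ∪ L₂`. -/
theorem folner_semidirect_abelian_normal_closure {G : Type*} [Group G] [DecidableEq G]
    (L₁ L₂ : Finset G) (hdisj : Disjoint L₁ L₂)
    (hgen : Subgroup.closure ((L₁ ∪ L₂ : Finset G) : Set G) = ⊤)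
    (hab : ∀ a ∈ Subgroup.normalClosure (L₁ : Set G),
      ∀ b ∈ Subgroup.normalClosure (L₁ : Set G), Commute a b)
    (hint : Subgroup.normalClosure (L₁ : Set G) ⊓ Subgroup.closure (L₂ : Set G) = ⊥)
    (hprod : ∀ g : G, ∃ a ∈ Subgroup.normalClosure (L₁ : Set G),
      ∃ b ∈ Subgroup.closure (L₂ : Set G), g = a * b)
    (n : ℕ) (hn : 1 ≤ n)
    (A : Finset G) (hAsub : (A : Set G) ⊆ (Subgroup.closure (L₂ : Set G) : Set G))
    (hA : IsFolner L₂ n A)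
    (s : ℕ) (y : Fin s → G)
    (hy : Set.range y = {g | ∃ a ∈ A, ∃ x ∈ L₁, g = a⁻¹ * x * a}) :
    IsFolner (L₁ ∪ L₂) n (A * Cube n y) := by
  set N := Subgroup.normalClosure (L₁ : Set G)
  have hyr (a : G) (ha : a ∈ A) (x : G) (hx : x ∈ L₁) : ∃ j, y j = a⁻¹ * x * a := by
    have h : a⁻¹ * x * a ∈ Set.range y := hy ▸ ⟨a, ha, x, hx, rfl⟩
    exact h
  have hyN (t : Fin s) : y t ∈ N := by
    have h : y t ∈ {g | ∃ a ∈ A, ∃ x ∈ L₁, g = a⁻¹ * x * a} := hy ▸ ⟨t, rfl⟩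
    obtain ⟨a, -, x, hx, h⟩ := h
    rw [h]
    exact (inferInstance : N.Normal).conj_mem' x (Subgroup.subset_normalClosure hx) a
  have hc (i j : Fin s) : Commute (y i) (y j) := hab _ (hyN i) _ (hyN j)
  have hcard : (A * Cube n y).card = A.card * (Cube n y).card :=
    card_mul_of_inf_eq_bot hint (fun a ha => hAsub ha) (cube_subset hyN)
  have hne : (A * Cube n y).Nonempty := hA.1.mul (cube_nonempty hn y)
  refine ⟨hne, fun x hx => (card_div_card_le_one_div_iff hn hne.card_pos).2 ?_⟩
  rw [hcard]
  rcases Finset.mem_union.1 hx with hx | hx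
  · calc n * ((A * Cube n y) \ (A * Cube n y).image (x * ·)).card
        ≤ n * ∑ a ∈ A, (Cube n y \ (Cube n y).image (a⁻¹ * x * a * ·)).card := by
          refine Nat.mul_le_mul_left n ?_
          refine (Finset.card_le_card (mul_sdiff_image_mul_subset_biUnion A _ x)).trans ?_
          exact Finset.card_biUnion_le.trans (Finset.sum_le_sum fun a _ => Finset.card_image_le)
      _ = ∑ a ∈ A, n * (Cube n y \ (Cube n y).image (a⁻¹ * x * a * ·)).card :=
          Finset.mul_sum _ _ _
      _ ≤ ∑ _a ∈ A, (Cube n y).card := by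
          refine Finset.sum_le_sum fun a ha => ?_
          obtain ⟨j, hj⟩ := hyr a ha x hx
          rw [← hj]
          refine mul_card_sdiff_image_le fun c hcd k hk => ?_
          obtain ⟨hcC, hcy⟩ := Finset.mem_sdiff.1 hcd
          exact pow_mul_mem_cube hc j hcC hcy hk
      _ = A.card * (Cube n y).card := by rw [Finset.sum_const, smul_eq_mul]
  · calc n * ((A * Cube n y) \ (A * Cube n y).image (x * ·)).card
        ≤ n * ((A \ A.image (x * ·)).card * (Cube n y).card) :=
          Nat.mul_le_mul_left n <|
            (Finset.card_le_card (mul_sdiff_image_mul_subset A _ x)).trans Finset.card_mul_le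
      _ = n * (A \ A.image (x * ·)).card * (Cube n y).card := (mul_assoc _ _ _).symm
      _ ≤ A.card * (Cube n y).card :=
          Nat.mul_le_mul_right _ <|
            (card_div_card_le_one_div_iff hn hA.1.card_pos).1 (hA.2 x hx)
end

section
/- Let Γ be a group generated by a finite set X, let N ◁ Γ be an abelian normal subgroup, and let ρ : Γ → Γ/N be the canonical projection. Let n ≥ 1 and let A ⊆ Γ be a finite subset such that ρ restricted to A is injective (|A| = |ρ(A)|) and ρ(A) is a 2n-Følner set for Γ/N with respect to ρ(X). Then A · C_{2n|A|²}(A⁻¹XA ∩ N) is an n-Følner set for Γ with respect to X, where A⁻¹XA ∩ N := {a⁻¹ x a' : a, a' ∈ A, x ∈ X} ∩ N (a finite set of pairwise commuting elements of N) and C_{2n|A|²} is formed from any finite enumeration of this set. -/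
open scoped Pointwise

variable {G : Type*} [Group G] [DecidableEq G]

/-- Multiplying one entry of a list by an element commuting with all entries multiplies the
product by that element. -/
theorem prod_ofFn_update_mul {M : Type*} [Monoid M] {s : ℕ} (f : Fin s → M) (g : M)
    (hc : ∀ i, Commute g (f i)) (j : Fin s) :
    (List.ofFn (Function.update f j (g * f j))).prod = g * (List.ofFn f).prod := by
  induction s with
  | zero => exact j.elim0
  | succ s ih =>
    rw [List.ofFn_succ, List.ofFn_succ, List.prod_cons, List.prod_cons]
    refine Fin.cases ?_ (fun k => ?_) j
    · simp [mul_assoc]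
    · have h : (fun i : Fin s => Function.update f k.succ (g * f k.succ) i.succ)
          = Function.update (fun i : Fin s => f i.succ) k (g * f k.succ) := by
        funext i
        by_cases hi : i = k
        · subst hi; simp
        · simp [Function.update_of_ne, hi]
      rw [h, ih (fun i => f i.succ) (fun i => hc i.succ) k,
        Function.update_of_ne (Fin.succ_ne_zero k).symm, ← mul_assoc, ← mul_assoc,
        (hc 0).eq]

theorem mem_Cube {G : Type*} [Group G] [DecidableEq G] {m s : ℕ} {y : Fin s → G} {g : G} :
    g ∈ Cube m y ↔
      ∃ e : Fin s → ℕ, (∀ i, e i < m) ∧ (List.ofFn fun j => y j ^ e j).prod = g := by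
  simp only [Cube, Finset.mem_image, Finset.mem_univ, true_and]
  constructor
  · rintro ⟨e, rfl⟩
    exact ⟨fun i => e i, fun i => (e i).2, rfl⟩
  · rintro ⟨e, he, rfl⟩
    exact ⟨fun i => ⟨e i, he i⟩, rfl⟩

theorem prod_ofFn_pow_update_add {G : Type*} [Group G] {s : ℕ} {y : Fin s → G}
    (hy : ∀ i j, Commute (y i) (y j)) (e : Fin s → ℕ) (j : Fin s) (k : ℕ) :
    (List.ofFn fun i => y i ^ Function.update e j (k + e j) i).prod
      = y j ^ k * (List.ofFn fun i => y i ^ e i).prod := by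
  rw [← prod_ofFn_update_mul (fun i => y i ^ e i) (y j ^ k) (fun i => (hy j i).pow_pow _ _) j]
  congr 2
  funext i
  by_cases hi : i = j
  · subst hi; simp [pow_add]
  · simp [Function.update_of_ne, hi]

theorem inv_mul_mem_Cube_or_pow_mul_mem_Cube {G : Type*} [Group G] [DecidableEq G]
    {m s : ℕ} {y : Fin s → G} (hy : ∀ i j, Commute (y i) (y j)) (j : Fin s) {z : G}
    (hz : z ∈ Cube m y) :
    (y j)⁻¹ * z ∈ Cube m y ∨ ∀ k < m, y j ^ k * z ∈ Cube m y := by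
  obtain ⟨e, he, rfl⟩ := mem_Cube.1 hz
  rcases Nat.eq_zero_or_pos (e j) with h0 | hpos
  · refine Or.inr fun k hk => mem_Cube.2
      ⟨Function.update e j (k + e j), fun i => ?_, prod_ofFn_pow_update_add hy e j k⟩
    by_cases hi : i = j
    · subst hi; simpa [h0] using hk
    · simpa [Function.update_of_ne, hi] using he i
  · refine Or.inl (mem_Cube.2 ⟨Function.update e j (e j - 1), fun i => ?_, ?_⟩)
    · by_cases hi : i = j
      · subst hi
        have := he i
        simp only [Function.update_self]
        omega
      · simpa [Function.update_of_ne, hi] using he i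
    · have h := prod_ofFn_pow_update_add hy (Function.update e j (e j - 1)) j 1
      rw [Function.update_self, Function.update_idem, Nat.add_sub_cancel' hpos,
        Function.update_eq_self, pow_one] at h
      rw [h, inv_mul_cancel_left]

/-- If every `z ∈ C` with `g⁻¹ * z ∉ C` starts a progression of length `m` inside `C`, then
there are at most `|C| / m` such elements. -/
theorem mul_card_filter_inv_mul_notMem_le {G : Type*} [Group G] [DecidableEq G]
    {m : ℕ} {C : Finset G} {g : G}
    (h : ∀ z ∈ C, g⁻¹ * z ∈ C ∨ ∀ k < m, g ^ k * z ∈ C) :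
    m * (C.filter fun z => g⁻¹ * z ∉ C).card ≤ C.card := by
  have hstart : ∀ z ∈ C.filter (fun z => g⁻¹ * z ∉ C), ∀ k < m, g ^ k * z ∈ C := by
    intro z hz
    rw [Finset.mem_filter] at hz
    exact (h z hz.1).resolve_left hz.2
  have hle : ∀ i j : ℕ, ∀ z ∈ C.filter (fun z => g⁻¹ * z ∉ C),
      ∀ w ∈ C.filter (fun z => g⁻¹ * z ∉ C), j < m → g ^ i * z = g ^ j * w → j ≤ i := by
    intro i j z hz w hw hj heq
    by_contra! hij
    obtain ⟨d, rfl⟩ := Nat.exists_eq_add_of_lt hij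
    refine (Finset.mem_filter.1 hz).2 ?_
    have hz' : g⁻¹ * z = g ^ d * w := by
      rw [add_assoc, pow_add, mul_assoc] at heq
      rw [mul_left_cancel heq, pow_succ', mul_assoc, inv_mul_cancel_left]
    rw [hz']
    exact hstart w hw d (by omega)
  rw [← Finset.card_range m, ← Finset.card_product]
  refine Finset.card_le_card_of_injOn (fun p : ℕ × G => g ^ p.1 * p.2) ?_ ?_
  · rintro ⟨k, z⟩ hp
    rw [Finset.mem_coe, Finset.mem_product, Finset.mem_range] at hp
    exact hstart z hp.2 k hp.1
  · rintro ⟨i, z⟩ hp ⟨j, w⟩ hq heq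
    rw [Finset.mem_coe, Finset.mem_product, Finset.mem_range] at hp hq
    obtain rfl : i = j :=
      le_antisymm (hle j i w hq.2 z hp.2 hp.1 heq.symm) (hle i j z hp.2 w hq.2 hq.1 heq)
    exact Prod.ext rfl (mul_left_cancel heq)

theorem card_mul_of_injOn_mk {G : Type*} [Group G] [DecidableEq G]
    (N : Subgroup G) [N.Normal] {A C : Finset G}
    (hinj : Set.InjOn (QuotientGroup.mk' N) A) (hC : ∀ c ∈ C, c ∈ N) :
    (A * C).card = A.card * C.card := by
  rw [Finset.card_mul_iff]
  rintro ⟨a, c⟩ hp ⟨b, d⟩ hq heq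
  simp only [Set.mem_prod, Finset.mem_coe] at hp hq heq
  have h := congrArg (QuotientGroup.mk' N) heq
  rw [map_mul, map_mul, QuotientGroup.mk'_apply, QuotientGroup.mk'_apply, QuotientGroup.mk'_apply,
    QuotientGroup.mk'_apply, (QuotientGroup.eq_one_iff c).2 (hC c hp.2),
    (QuotientGroup.eq_one_iff d).2 (hC d hq.2), mul_one, mul_one] at h
  obtain rfl := hinj hp.1 hq.1 h
  exact Prod.ext rfl (mul_left_cancel heq)

theorem isFolner_iff {G : Type*} [Group G] [DecidableEq G] {X : Finset G} {n : ℕ} (hn : 0 < n)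
    {F : Finset G} :
    IsFolner X n F ↔
      F.Nonempty ∧ ∀ x ∈ X, n * (F \ F.image (x * ·)).card ≤ F.card := by
  refine and_congr_right fun hF => forall₂_congr fun x _ => ?_
  have hF' : (0 : ℚ) < F.card := by exact_mod_cast hF.card_pos
  have hn' : (0 : ℚ) < n := by exact_mod_cast hn
  rw [div_le_div_iff₀ hF' hn', one_mul, mul_comm]
  exact_mod_cast Iff.rfl

/-- Abelian extensions: if `ρ(A)` is a `2n`-Følner set of `Γ/N` with `ρ` injective on `A`,
then `A · C_{2n|A|²}(A⁻¹XA ∩ N)` is an `n`-Følner set of `Γ`. -/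
theorem folner_abelian_extension {G : Type*} [Group G] [DecidableEq G]
    (X : Finset G) (hX : Subgroup.closure (X : Set G) = ⊤)
    (N : Subgroup G) [N.Normal]
    (hab : ∀ a ∈ N, ∀ b ∈ N, Commute a b)
    [DecidableEq (G ⧸ N)]
    (n : ℕ) (hn : 1 ≤ n)
    (A : Finset G) (hinj : Set.InjOn (QuotientGroup.mk' N) A)
    (hA : IsFolner (X.image (QuotientGroup.mk' N)) (2 * n) (A.image (QuotientGroup.mk' N)))
    (s : ℕ) (y : Fin s → G)
    (hy : Set.range y = {g | (∃ a ∈ A, ∃ x ∈ X, ∃ a' ∈ A, g = a⁻¹ * x * a') ∧ g ∈ N}) :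
    IsFolner X n (A * Cube (2 * n * A.card ^ 2) y) := by
  have hn2 : 0 < 2 * n := by omega
  obtain ⟨hAne, hAle⟩ := (isFolner_iff hn2).1 hA
  rw [Finset.image_nonempty] at hAne
  rw [Finset.card_image_of_injOn hinj] at hAle
  have hyN : ∀ j, y j ∈ N := fun j => (hy.subset ⟨j, rfl⟩).2
  have hyc : ∀ i j, Commute (y i) (y j) := fun i j => hab _ (hyN i) _ (hyN j)
  set m := 2 * n * A.card ^ 2 with hm
  have hmn : 2 * n ≤ m := Nat.le_mul_of_pos_right _ (pow_pos hAne.card_pos 2)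
  set C := Cube m y with hCdef
  have hCN : ∀ c ∈ C, c ∈ N := by
    intro c hc
    obtain ⟨e, -, rfl⟩ := mem_Cube.1 hc
    refine N.list_prod_mem fun z hz => ?_
    obtain ⟨j, rfl⟩ := (List.mem_ofFn' _ _).1 hz
    exact N.pow_mem (hyN j) _
  have hCne : C.Nonempty := ⟨_, mem_Cube.2 ⟨fun _ => 0, fun _ => hn2.trans_le hmn, rfl⟩⟩
  refine (isFolner_iff hn).2 ⟨hAne.mul hCne, fun x hx => ?_⟩
  rw [card_mul_of_injOn_mk N hinj hCN]
  set B := A.filter fun a => QuotientGroup.mk' N a ∉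
    (A.image (QuotientGroup.mk' N)).image (QuotientGroup.mk' N x * ·) with hB
  have hBcard : 2 * n * B.card ≤ A.card := by
    refine le_trans (Nat.mul_le_mul_left _ ?_) (hAle _ (Finset.mem_image_of_mem _ hx))
    rw [← Finset.card_image_of_injOn (hinj.mono (Finset.filter_subset _ A))]
    refine Finset.card_le_card fun q hq => ?_
    obtain ⟨a, ha, rfl⟩ := Finset.mem_image.1 hq
    rw [Finset.mem_filter] at ha
    exact Finset.mem_sdiff.2 ⟨Finset.mem_image_of_mem _ ha.1, ha.2⟩
  set E : G → Finset G := fun a => C.filter fun c => a * c ∉ (A * C).image (x * ·) with hE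
  have hEcard : ∀ a ∈ A \ B, ((E a).image (a * ·)).card ≤ C.card / (2 * n) := by
    intro a ha
    rw [Finset.mem_sdiff, hB, Finset.mem_filter, not_and, not_not] at ha
    obtain ⟨haA, hq⟩ := ha
    obtain ⟨q, hq', hqa⟩ := Finset.mem_image.1 (hq haA)
    obtain ⟨b, hb, rfl⟩ := Finset.mem_image.1 hq'
    have hmem : a⁻¹ * x * b ∈ N := by
      rw [mul_assoc]
      exact QuotientGroup.eq.1 hqa.symm
    obtain ⟨j, hj⟩ := hy.superset ⟨⟨a, haA, x, hx, b, hb, rfl⟩, hmem⟩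
    have hsub : E a ⊆ C.filter fun c => (y j)⁻¹ * c ∉ C := by
      refine Finset.monotone_filter_right _ fun c _ hc hc' => hc ?_
      refine Finset.mem_image.2 ⟨b * ((y j)⁻¹ * c), Finset.mul_mem_mul hb hc', ?_⟩
      simp only [hj]
      group
    rw [Nat.le_div_iff_mul_le hn2, mul_comm]
    exact (Nat.mul_le_mul hmn (Finset.card_image_le.trans (Finset.card_le_card hsub))).trans
      (mul_card_filter_inv_mul_notMem_le fun z hz =>
        inv_mul_mem_Cube_or_pow_mul_mem_Cube hyc j hz)
  have hcover : (A * C) \ (A * C).image (x * ·) ⊆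
      B * C ∪ (A \ B).biUnion fun a => (E a).image (a * ·) := by
    intro g hg
    rw [Finset.mem_sdiff] at hg
    obtain ⟨a, ha, c, hc, rfl⟩ := Finset.mem_mul.1 hg.1
    by_cases haB : a ∈ B
    · exact Finset.mem_union_left _ (Finset.mul_mem_mul haB hc)
    · exact Finset.mem_union_right _ (Finset.mem_biUnion.2
        ⟨a, Finset.mem_sdiff.2 ⟨ha, haB⟩,
          Finset.mem_image_of_mem _ (Finset.mem_filter.2 ⟨hc, hg.2⟩)⟩)
  have hcard : ((A * C) \ (A * C).image (x * ·)).card ≤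
      B.card * C.card + A.card * (C.card / (2 * n)) :=
    (Finset.card_le_card hcover).trans <| (Finset.card_union_le _ _).trans <|
      add_le_add Finset.card_mul_le <| (Finset.card_biUnion_le_card_mul _ _ _ hEcard).trans <|
        Nat.mul_le_mul_right _ (Finset.card_le_card Finset.sdiff_subset)
  have hK : 2 * n * (C.card / (2 * n)) ≤ C.card := Nat.mul_div_le _ _
  refine Nat.le_of_mul_le_mul_left (?_ : 2 * _ ≤ 2 * _) two_pos
  calc 2 * (n * ((A * C) \ (A * C).image (x * ·)).card)
      ≤ 2 * (n * (B.card * C.card + A.card * (C.card / (2 * n)))) := by gcongr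
    _ = (2 * n * B.card) * C.card + A.card * (2 * n * (C.card / (2 * n))) := by ring
    _ ≤ A.card * C.card + A.card * C.card := by gcongr
    _ = 2 * (A.card * C.card) := by ring
end

section
/- Let Γ be a group generated by a finite set X, let N be a normal subgroup of Γ generated by a finite set Y, let K := Γ/N with canonical projection ρ : Γ → K, and let Δ_N^Γ(m) := max{|ω|_Y : ω ∈ N, |ω|_X ≤ m} denote the distortion function of N in Γ. Let n ≥ 1, let A ⊆ Γ be a finite subset such that A' := ρ(A) is a 2n-Følner set for K with respect to ρ(X), ρ is injective on A (|A| = |A'|), and |A|_X ≤ |A'|_{ρ(X)}, and let B be a (2n·|A'|²·Δ_N^Γ(2|A'|_{ρ(X)}+1))-Følner set for N with respect to Y. Then A·B is an n-Følner set for Γ with respect to X. -/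
open scoped Pointwise

variable {G : Type*} [Group G] [DecidableEq G]

section WordLength

variable {H : Type*} [Group H]

theorem exists_list_of_mem_closure {S : Set H} {g : H} (hg : g ∈ Subgroup.closure S) :
    ∃ w : List H, (∀ a ∈ w, a ∈ S ∨ a⁻¹ ∈ S) ∧ w.length = wordLength S g ∧ w.prod = g := by
  rw [← Subgroup.mem_toSubmonoid, Subgroup.closure_toSubmonoid] at hg
  obtain ⟨w, hw, hprod⟩ := Submonoid.exists_list_of_mem_closure hg
  exact Nat.sInf_mem (s := {k | ∃ w : List H, (∀ a ∈ w, a ∈ S ∨ a⁻¹ ∈ S) ∧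
    w.length = k ∧ w.prod = g}) ⟨w.length, w, hw, rfl, hprod⟩

theorem wordLength_prod_le {S : Set H} {w : List H} (hw : ∀ a ∈ w, a ∈ S ∨ a⁻¹ ∈ S) :
    wordLength S w.prod ≤ w.length :=
  Nat.sInf_le ⟨w, hw, rfl, rfl⟩

theorem wordLength_mul_le_s14 {S : Set H} {g h : H} (hg : g ∈ Subgroup.closure S)
    (hh : h ∈ Subgroup.closure S) :
    wordLength S (g * h) ≤ wordLength S g + wordLength S h := by
  obtain ⟨v, hv, hvl, rfl⟩ := exists_list_of_mem_closure hg
  obtain ⟨w, hw, hwl, rfl⟩ := exists_list_of_mem_closure hh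
  rw [← hvl, ← hwl, ← List.prod_append, ← List.length_append]
  refine wordLength_prod_le fun a ha => ?_
  rcases List.mem_append.1 ha with h | h
  exacts [hv a h, hw a h]

theorem wordLength_inv_le {S : Set H} {g : H} (hg : g ∈ Subgroup.closure S) :
    wordLength S g⁻¹ ≤ wordLength S g := by
  obtain ⟨w, hw, hwl, rfl⟩ := exists_list_of_mem_closure hg
  have hlen : w.length = (w.map (·⁻¹)).reverse.length := by simp
  rw [← hwl, List.prod_inv_reverse, hlen]
  refine wordLength_prod_le fun a ha => ?_
  obtain ⟨b, hb, rfl⟩ := List.mem_map.1 (List.mem_reverse.1 ha)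
  simpa using (hw b hb).symm

theorem wordLength_le_one {S : Set H} {g : H} (hg : g ∈ S) : wordLength S g ≤ 1 := by
  simpa using wordLength_prod_le (S := S) (w := [g]) (by simp [hg])

theorem finite_setOf_wordLength_le {S : Set H} (hS : S.Finite)
    (htop : Subgroup.closure S = ⊤) (m : ℕ) : {g | wordLength S g ≤ m}.Finite := by
  have : Finite ↥(S ∪ S⁻¹) := hS.union hS.inv
  refine ((List.finite_length_le ↥(S ∪ S⁻¹) m).image
    fun w => (w.map Subtype.val).prod).subset fun g hg => ?_
  obtain ⟨w, hw, hwl, rfl⟩ := exists_list_of_mem_closure (S := S) (g := g) (htop ▸ trivial)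
  rw [Set.mem_ofPred_eq, ← hwl] at hg
  lift w to List ↥(S ∪ S⁻¹) using hw
  exact ⟨w, by simpa using hg, rfl⟩

theorem wordLength_le_distortion {X Y : Finset H} (hX : Subgroup.closure (X : Set H) = ⊤)
    {N : Subgroup H} {ω : H} (hω : ω ∈ N) {m : ℕ} (hm : wordLength (X : Set H) ω ≤ m) :
    wordLength (Y : Set H) ω ≤ distortion X Y N m := by
  refine le_csSup ?_ ⟨ω, hω, hm, rfl⟩
  refine (((finite_setOf_wordLength_le X.finite_toSet hX m).image
    (wordLength (Y : Set H))).subset ?_).bddAbove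
  rintro _ ⟨g, -, hg, rfl⟩
  exact ⟨g, hg, rfl⟩

end WordLength

section Boundary

variable {H : Type*} [Group H] [DecidableEq H]

theorem card_sdiff_image_mul_mul_le (B : Finset H) (a b : H) :
    (B \ B.image (a * b * ·)).card ≤
      (B \ B.image (a * ·)).card + (B \ B.image (b * ·)).card := by
  have hb : (B \ B.image (b * ·)).card = (B.image (a * ·) \ B.image (a * b * ·)).card := by
    rw [← Finset.card_image_of_injective _ (mul_right_injective a),
      Finset.image_sdiff _ _ (mul_right_injective a), Finset.image_image]
    simp only [Function.comp_def, mul_assoc]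
  rw [hb]
  refine (Finset.card_le_card fun z hz => ?_).trans (Finset.card_union_le _ _)
  simp only [Finset.mem_union, Finset.mem_sdiff] at hz ⊢
  tauto

theorem card_sdiff_image_inv_mul (B : Finset H) (a : H) :
    (B \ B.image (a⁻¹ * ·)).card = (B \ B.image (a * ·)).card := by
  rw [← Finset.card_image_of_injective _ (mul_right_injective a),
    Finset.image_sdiff _ _ (mul_right_injective a), Finset.image_image]
  simp only [Function.comp_def, mul_inv_cancel_left, Finset.image_id']
  exact Finset.card_sdiff_comm (Finset.card_image_of_injective _ (mul_right_injective a))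

theorem card_sdiff_image_list_prod_mul_le {Y B : Finset H} {c : ℚ}
    (hc : ∀ y ∈ Y, ((B \ B.image (y * ·)).card : ℚ) ≤ c) {w : List H}
    (hw : ∀ a ∈ w, a ∈ (Y : Set H) ∨ a⁻¹ ∈ (Y : Set H)) :
    ((B \ B.image (w.prod * ·)).card : ℚ) ≤ w.length * c := by
  induction w with
  | nil => simp
  | cons a w ih =>
    have ha : ((B \ B.image (a * ·)).card : ℚ) ≤ c := by
      rcases hw a (by simp) with h | h
      · exact hc a h
      · rw [← card_sdiff_image_inv_mul]
        exact hc _ h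
    have hcard : ((B \ B.image ((a :: w).prod * ·)).card : ℚ) ≤
        (B \ B.image (a * ·)).card + (B \ B.image (w.prod * ·)).card := by
      rw [List.prod_cons]
      exact_mod_cast card_sdiff_image_mul_mul_le B a w.prod
    have := ih fun b hb => hw b (by simp [hb])
    rw [List.length_cons]
    push_cast
    linarith

/-- Translating by an element of word length at most `D` moves at most a `1 / k` part of a
`(k * D)`-Følner set. -/
theorem IsFolner.card_sdiff_image_mul_le {Y B : Finset H} {k D : ℕ} (hB : IsFolner Y (k * D) B)
    {ω : H} (hω : ω ∈ Subgroup.closure (Y : Set H)) (hD : wordLength (Y : Set H) ω ≤ D) :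
    ((B \ B.image (ω * ·)).card : ℚ) ≤ B.card / k := by
  have hpos : (0 : ℚ) < B.card := by exact_mod_cast hB.1.card_pos
  obtain ⟨w, hw, hwl, rfl⟩ := exists_list_of_mem_closure hω
  have hle := card_sdiff_image_list_prod_mul_le (B := B)
    (c := 1 / ((k * D : ℕ) : ℚ) * B.card) (fun y hy => (div_le_iff₀ hpos).1 (hB.2 y hy)) hw
  refine hle.trans ?_
  have hlen : (w.length : ℚ) ≤ D := by exact_mod_cast hwl ▸ hD
  calc (w.length : ℚ) * (1 / ((k * D : ℕ) : ℚ) * B.card)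
      ≤ D * (1 / ((k * D : ℕ) : ℚ) * B.card) := by gcongr
    _ = (D / D : ℚ) * (B.card / k) := by push_cast; ring
    _ ≤ 1 * (B.card / k) := by gcongr; exact div_self_le_one _
    _ = B.card / k := one_mul _

theorem card_mul_of_injOn_mk_s14 {N : Subgroup H} [N.Normal] {A B : Finset H}
    (hinj : Set.InjOn (QuotientGroup.mk' N) A) (hBN : (B : Set H) ⊆ N) :
    (A * B).card = A.card * B.card := by
  refine Finset.card_mul_iff.2 ?_
  rintro ⟨a, b⟩ ⟨ha, hb⟩ ⟨a', b'⟩ ⟨ha', hb'⟩ h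
  have hmk : ∀ b ∈ B, QuotientGroup.mk' N b = 1 := fun b hb =>
    (QuotientGroup.eq_one_iff b).2 (hBN hb)
  obtain rfl : a = a' := hinj ha ha' <| by
    have h' := congrArg (QuotientGroup.mk' N) h
    rwa [map_mul, map_mul, hmk b hb, hmk b' hb', mul_one, mul_one] at h'
  simpa using h

/-- The boundary of `A * B` is covered by the columns over the boundary of `A` in the quotient,
and, over each other `a ∈ A`, by the boundary of `B` under a translation from `N`. -/
theorem card_mul_sdiff_image_mul_le {N : Subgroup H} [N.Normal] [DecidableEq (H ⧸ N)]
    {A B : Finset H} (hinj : Set.InjOn (QuotientGroup.mk' N) A) (x : H) {c : ℚ} (hc : 0 ≤ c)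
    (h : ∀ a ∈ A, ∀ a' ∈ A, a⁻¹ * x * a' ∈ N →
      ((B \ B.image ((a⁻¹ * x * a') * ·)).card : ℚ) ≤ c) :
    (((A * B) \ (A * B).image (x * ·)).card : ℚ) ≤
      (A.image (QuotientGroup.mk' N) \
        (A.image (QuotientGroup.mk' N)).image (QuotientGroup.mk' N x * ·)).card * B.card +
      A.card * c := by
  classical
  set ρ := QuotientGroup.mk' N with hρ
  set E := A.filter fun a => ρ a ∉ (A.image ρ).image (ρ x * ·) with hE
  have hEcard : E.card = (A.image ρ \ (A.image ρ).image (ρ x * ·)).card := by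
    rw [← Finset.card_image_of_injOn (hinj.mono (Finset.coe_subset.2 (Finset.filter_subset _ A)))]
    congr 1
    ext z
    simp only [Finset.mem_image, Finset.mem_filter, Finset.mem_sdiff]
    constructor
    · rintro ⟨a, ⟨ha, hn⟩, rfl⟩
      exact ⟨⟨a, ha, rfl⟩, hn⟩
    · rintro ⟨⟨a, ha, rfl⟩, hn⟩
      exact ⟨a, ⟨ha, hn⟩, rfl⟩
  let C : H → Finset H := fun a => B.filter fun b => a * b ∉ (A * B).image (x * ·)
  have hC : ∀ a ∈ A \ E, ((C a).card : ℚ) ≤ c := by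
    intro a ha
    simp only [hE, Finset.mem_sdiff, Finset.mem_filter, not_and, not_not] at ha
    obtain ⟨ha, hmem⟩ := ha
    obtain ⟨q, hq, hqa⟩ := Finset.mem_image.1 (hmem ha)
    obtain ⟨a', ha', rfl⟩ := Finset.mem_image.1 hq
    have hN : a⁻¹ * x * a' ∈ N := by
      rw [mul_assoc]
      exact QuotientGroup.eq.1 hqa.symm
    refine le_trans ?_ (h a ha a' ha' hN)
    refine Nat.cast_le.2 (Finset.card_le_card fun b hb => ?_)
    obtain ⟨hbB, hb⟩ := Finset.mem_filter.1 hb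
    refine Finset.mem_sdiff.2 ⟨hbB, fun hb' => hb ?_⟩
    obtain ⟨b', hb'B, rfl⟩ := Finset.mem_image.1 hb'
    exact Finset.mem_image.2 ⟨a' * b', Finset.mul_mem_mul ha' hb'B, by group⟩
  have hcover : (A * B) \ (A * B).image (x * ·) ⊆
      E * B ∪ (A \ E).biUnion fun a => (C a).image (a * ·) := by
    intro z hz
    obtain ⟨hz, hzx⟩ := Finset.mem_sdiff.1 hz
    obtain ⟨a, ha, b, hb, rfl⟩ := Finset.mem_mul.1 hz
    by_cases haE : a ∈ E
    · exact Finset.mem_union_left _ (Finset.mul_mem_mul haE hb)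
    · exact Finset.mem_union_right _ (Finset.mem_biUnion.2 ⟨a, Finset.mem_sdiff.2 ⟨ha, haE⟩,
        Finset.mem_image.2 ⟨b, Finset.mem_filter.2 ⟨hb, hzx⟩, rfl⟩⟩)
  have hcard : ((A * B) \ (A * B).image (x * ·)).card ≤
      E.card * B.card + ∑ a ∈ A \ E, (C a).card :=
    (Finset.card_le_card hcover).trans <| (Finset.card_union_le _ _).trans <|
      add_le_add Finset.card_mul_le <| Finset.card_biUnion_le.trans <|
        Finset.sum_le_sum fun a _ => Finset.card_image_le
  have hsum : (∑ a ∈ A \ E, ((C a).card : ℚ)) ≤ A.card * c :=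
    calc (∑ a ∈ A \ E, ((C a).card : ℚ)) ≤ ∑ _a ∈ A \ E, c := Finset.sum_le_sum hC
      _ = (A \ E).card * c := by rw [Finset.sum_const, nsmul_eq_mul]
      _ ≤ A.card * c := by gcongr; exact Finset.sdiff_subset
  rw [← hEcard]
  calc (((A * B) \ (A * B).image (x * ·)).card : ℚ)
      ≤ E.card * B.card + ∑ a ∈ A \ E, ((C a).card : ℚ) := by exact_mod_cast hcard
    _ ≤ _ := by gcongr

end Boundary

/-- General extensions: if `A' = ρ(A)` is a `2n`-Følner set of `K = Γ/N` with `ρ` injective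
on `A` and `|A|_X ≤ |A'|_{ρ(X)}`, and `B` is a
`(2n·|A'|²·Δ_N^Γ(2|A'|_{ρ(X)}+1))`-Følner set of `N` w.r.t. `Y`, then `A·B` is an
`n`-Følner set of `Γ` w.r.t. `X`. -/
theorem folner_general_extension {G : Type*} [Group G] [DecidableEq G]
    (X Y : Finset G) (hX : Subgroup.closure (X : Set G) = ⊤)
    (N : Subgroup G) [N.Normal]
    (hYN : Subgroup.closure (Y : Set G) = N)
    [DecidableEq (G ⧸ N)]
    (n : ℕ) (hn : 1 ≤ n)
    (A : Finset G) (hinj : Set.InjOn (QuotientGroup.mk' N) A)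
    (hA' : IsFolner (X.image (QuotientGroup.mk' N)) (2 * n) (A.image (QuotientGroup.mk' N)))
    (hlen : A.sup (wordLength (X : Set G)) ≤
      (A.image (QuotientGroup.mk' N)).sup
        (wordLength ((X.image (QuotientGroup.mk' N) : Finset (G ⧸ N)) : Set (G ⧸ N))))
    (B : Finset G) (hBN : (B : Set G) ⊆ (N : Set G))
    (hB : IsFolner Y
      (2 * n * (A.image (QuotientGroup.mk' N)).card ^ 2 *
        distortion X Y N
          (2 * (A.image (QuotientGroup.mk' N)).sup
            (wordLength ((X.image (QuotientGroup.mk' N) : Finset (G ⧸ N)) : Set (G ⧸ N))) + 1))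
      B) :
    IsFolner X n (A * B) := by
  have hAne : A.Nonempty := Finset.image_nonempty.1 hA'.1
  have hApos : (0 : ℚ) < A.card := by exact_mod_cast hAne.card_pos
  have hA1 : (1 : ℚ) ≤ A.card := by exact_mod_cast hAne.card_pos
  have hBpos : (0 : ℚ) < B.card := by exact_mod_cast hB.1.card_pos
  have hn0 : (0 : ℚ) < n := by exact_mod_cast hn
  have hcardA : (A.image (QuotientGroup.mk' N)).card = A.card := Finset.card_image_of_injOn hinj
  refine ⟨hAne.mul hB.1, fun x hx => ?_⟩
  have hmem : ∀ g : G, g ∈ Subgroup.closure (X : Set G) := fun g => hX ▸ trivial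
  have hbase := hA'.2 _ (Finset.mem_image_of_mem (QuotientGroup.mk' N) hx)
  rw [hcardA, div_le_iff₀ hApos] at hbase
  have hfibre := card_mul_sdiff_image_mul_le (B := B) hinj x
    (c := B.card / (2 * n * (A.image (QuotientGroup.mk' N)).card ^ 2 : ℕ)) (by positivity)
    fun a ha a' ha' hN => hB.card_sdiff_image_mul_le (hYN ▸ hN) <| by
      refine wordLength_le_distortion hX hN ?_
      have h1 := wordLength_mul_le_s14 (hmem (a⁻¹ * x)) (hmem a')
      have h2 := wordLength_mul_le_s14 (hmem a⁻¹) (hmem x)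
      have h3 := wordLength_inv_le (hmem a)
      have h4 := wordLength_le_one (Finset.mem_coe.2 hx)
      have h5 := (Finset.le_sup (f := wordLength (X : Set G)) ha).trans hlen
      have h6 := (Finset.le_sup (f := wordLength (X : Set G)) ha').trans hlen
      omega
  rw [card_mul_of_injOn_mk_s14 hinj hBN, div_le_iff₀ (by push_cast; positivity)]
  refine hfibre.trans ?_
  rw [hcardA]
  push_cast at hbase ⊢
  calc _ ≤ 1 / (2 * (n : ℚ)) * A.card * B.card + A.card * (B.card / (2 * n * A.card ^ 2)) := by
        gcongr
    _ = 1 / (2 * (n : ℚ)) * A.card * B.card + 1 / (2 * (n : ℚ)) * B.card * (1 / A.card) := by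
        field_simp
    _ ≤ 1 / (2 * (n : ℚ)) * A.card * B.card + 1 / (2 * (n : ℚ)) * B.card * A.card := by
        gcongr
        exact ((div_le_one hApos).2 hA1).trans hA1
    _ = 1 / n * (A.card * B.card) := by
        field_simp
        ring
end

section
/- Let Γ be a group generated by disjoint finite subsets L₁ and L₂, with H₁ = ⟨L₁⟩, H₂ = ⟨L₂⟩, the normal closure H₁^Γ abelian, H₁^Γ ∩ H₂ = {1} and Γ = H₁^Γ · H₂. Suppose moreover that H₁^Γ has exponent p (y^p = 1 for all y ∈ H₁^Γ). Then for every n ≥ p and every n-Følner set A for H₂ with respect to L₂, the set A · C_p(L₁^A) is an n-Følner set for Γ with respect to L₁ ∪ L₂, where L₁^A := {a⁻¹ x a : a ∈ A, x ∈ L₁}. -/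
open scoped Pointwise

variable {G : Type*} [Group G] [DecidableEq G]

theorem mem_Cube_comp {M : Type*} [CommGroup M] (f : M →* G) (n : ℕ) {s : ℕ} (y : Fin s → M)
    (g : G) :
    g ∈ Cube n (fun j => f (y j)) ↔ ∃ i : Fin s → Fin n, f (∏ j, y j ^ (i j : ℕ)) = g := by
  simp only [Cube, Finset.mem_image, Finset.mem_univ, true_and, ← List.prod_ofFn, map_list_prod,
    List.map_ofFn, Function.comp_def, map_pow]

theorem mul_mem_Cube_comp {M : Type*} [CommGroup M] (f : M →* G) {p : ℕ} (hp : 1 ≤ p) {s : ℕ}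
    (y : Fin s → M) (hexp : ∀ j, y j ^ p = 1) (j : Fin s) {g : G}
    (hg : g ∈ Cube p (fun j => f (y j))) : f (y j) * g ∈ Cube p (fun j => f (y j)) := by
  rw [mem_Cube_comp] at hg ⊢
  obtain ⟨i, rfl⟩ := hg
  refine ⟨Function.update i j ⟨((i j : ℕ) + 1) % p, Nat.mod_lt _ hp⟩, ?_⟩
  rw [← map_mul]
  congr 1
  have h : y j = ∏ k, if k = j then y k else 1 := by simp
  rw [h, ← Finset.prod_mul_distrib]
  refine Finset.prod_congr rfl fun k _ => ?_
  by_cases hk : k = j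
  · subst hk
    simp only [Function.update_self, if_true]
    rw [← pow_eq_pow_mod _ (hexp k), pow_succ']
  · simp [hk]

theorem Cube_nonempty {n : ℕ} (hn : 1 ≤ n) {s : ℕ} (y : Fin s → G) : (Cube n y).Nonempty := by
  have : Nonempty (Fin n) := ⟨⟨0, hn⟩⟩
  exact Finset.univ_nonempty.image _

theorem card_mul_of_disjoint_subgroups {N H : Subgroup G} (h : N ⊓ H = ⊥) {A K : Finset G}
    (hA : ∀ a ∈ A, a ∈ H) (hK : ∀ k ∈ K, k ∈ N) : (A * K).card = A.card * K.card := by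
  rw [Finset.card_mul_iff]
  rintro ⟨a, k⟩ hak ⟨b, l⟩ hbl (hEq : a * k = b * l)
  simp only [Set.mem_prod, Finset.mem_coe] at hak hbl
  have hk : b⁻¹ * a = l * k⁻¹ := by
    rw [eq_mul_inv_iff_mul_eq, mul_assoc, hEq, inv_mul_cancel_left]
  have hmem : b⁻¹ * a ∈ N ⊓ H :=
    ⟨hk ▸ N.mul_mem (hK l hbl.2) (N.inv_mem (hK k hak.2)),
      H.mul_mem (H.inv_mem (hA b hbl.1)) (hA a hak.1)⟩
  rw [h, Subgroup.mem_bot, inv_mul_eq_one] at hmem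
  subst hmem
  rw [mul_right_inj] at hEq
  rw [hEq]

theorem sdiff_image_mul_subset (A K : Finset G) (x : G) :
    (A * K) \ (A * K).image (x * ·) ⊆ (A \ A.image (x * ·)) * K := by
  intro f hf
  obtain ⟨hf, hfx⟩ := Finset.mem_sdiff.1 hf
  obtain ⟨a, ha, k, hk, rfl⟩ := Finset.mem_mul.1 hf
  refine Finset.mul_mem_mul (Finset.mem_sdiff.2 ⟨ha, fun hax => hfx ?_⟩) hk
  obtain ⟨b, hb, rfl⟩ := Finset.mem_image.1 hax
  exact Finset.mem_image.2 ⟨b * k, Finset.mul_mem_mul hb hk, (mul_assoc x b k).symm⟩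

theorem sdiff_image_mul_left_eq_empty {F : Finset G} {x : G} (h : ∀ f ∈ F, x * f ∈ F) :
    F \ F.image (x * ·) = ∅ := by
  have hsub : F.image (x * ·) ⊆ F := Finset.image_subset_iff.2 h
  rw [Finset.eq_of_subset_of_card_le hsub
    (Finset.card_image_of_injective F (mul_right_injective x)).ge, Finset.sdiff_self]

/-- Exponent-`p` version: if moreover `H₁^Γ` has exponent `p` and `n ≥ p`, then
`A · C_p(L₁^A)` is an `n`-Følner set of `Γ` w.r.t. `L₁ ∪ L₂`, for every `n`-Følner
set `A` of `H₂`. -/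
theorem folner_semidirect_abelian_exponent {G : Type*} [Group G] [DecidableEq G]
    (L₁ L₂ : Finset G) (hdisj : Disjoint L₁ L₂)
    (hgen : Subgroup.closure ((L₁ ∪ L₂ : Finset G) : Set G) = ⊤)
    (hab : ∀ a ∈ Subgroup.normalClosure (L₁ : Set G),
      ∀ b ∈ Subgroup.normalClosure (L₁ : Set G), Commute a b)
    (hint : Subgroup.normalClosure (L₁ : Set G) ⊓ Subgroup.closure (L₂ : Set G) = ⊥)
    (hprod : ∀ g : G, ∃ a ∈ Subgroup.normalClosure (L₁ : Set G),
      ∃ b ∈ Subgroup.closure (L₂ : Set G), g = a * b)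
    (p : ℕ) (hp : 1 ≤ p)
    (hexp : ∀ g ∈ Subgroup.normalClosure (L₁ : Set G), g ^ p = 1)
    (n : ℕ) (hnp : p ≤ n)
    (A : Finset G) (hAsub : (A : Set G) ⊆ (Subgroup.closure (L₂ : Set G) : Set G))
    (hA : IsFolner L₂ n A)
    (s : ℕ) (y : Fin s → G)
    (hy : Set.range y = {g | ∃ a ∈ A, ∃ x ∈ L₁, g = a⁻¹ * x * a}) :
    IsFolner (L₁ ∪ L₂) n (A * Cube p y) := by
  have hyN : ∀ j, y j ∈ Subgroup.normalClosure (L₁ : Set G) := by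
    intro j
    obtain ⟨a, -, x, hx, hj⟩ := hy.subset ⟨j, rfl⟩
    rw [hj]
    simpa using Subgroup.normalClosure_normal.conj_mem x (Subgroup.subset_normalClosure hx) a⁻¹
  let _ : CommGroup (Subgroup.normalClosure (L₁ : Set G)) :=
    { (inferInstance : Group (Subgroup.normalClosure (L₁ : Set G))) with
      mul_comm := fun a b => Subtype.ext (hab a a.2 b b.2) }
  let f : Subgroup.normalClosure (L₁ : Set G) →* G := (Subgroup.normalClosure (L₁ : Set G)).subtype
  let z : Fin s → Subgroup.normalClosure (L₁ : Set G) := fun j => ⟨y j, hyN j⟩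
  have hKN : ∀ k ∈ Cube p y, k ∈ Subgroup.normalClosure (L₁ : Set G) := by
    intro k hk
    obtain ⟨i, rfl⟩ := (mem_Cube_comp f p z k).1 hk
    exact Subtype.prop _
  have hyK : ∀ j, ∀ k ∈ Cube p y, y j * k ∈ Cube p y := fun j k hk =>
    mul_mem_Cube_comp f hp z (fun j => Subtype.ext (hexp _ (hyN j))) j hk
  have hKne : (Cube p y).Nonempty := Cube_nonempty hp y
  refine ⟨hA.1.mul hKne, fun x hx => ?_⟩
  rcases Finset.mem_union.1 hx with hx | hx
  · rw [sdiff_image_mul_left_eq_empty]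
    · simp
    · intro g hg
      obtain ⟨a, ha, k, hk, rfl⟩ := Finset.mem_mul.1 hg
      obtain ⟨j, hj⟩ := hy.superset ⟨a, ha, x, hx, rfl⟩
      have hmul : x * (a * k) = a * (y j * k) := by rw [hj]; group
      rw [hmul]
      exact Finset.mul_mem_mul ha (hyK j k hk)
  · refine le_trans ?_ (hA.2 x hx)
    have hK0 : (0 : ℚ) < (Cube p y).card := by exact_mod_cast hKne.card_pos
    have hcard : (((A * Cube p y) \ (A * Cube p y).image (x * ·)).card : ℚ) ≤
        (A \ A.image (x * ·)).card * (Cube p y).card := by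
      exact_mod_cast (Finset.card_le_card (sdiff_image_mul_subset A _ x)).trans
        Finset.card_mul_le
    rw [card_mul_of_disjoint_subgroups hint (fun a ha => hAsub ha) hKN, Nat.cast_mul,
      ← mul_div_mul_right ((A \ A.image (x * ·)).card : ℚ) (A.card : ℚ) hK0.ne']
    gcongr
end
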